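/- Let X be a random vector in ℝ^d. Then ∫_{S^{d-1}} ∫_0^∞ √(P(|θᵀX| > t)) dt dσ(θ) < ∞ if and only if ∫_0^∞ √(P(‖X‖ > t)) dt < ∞, where σ is the uniform distribution on the unit sphere S^{d-1}. -/

import Mathlib

open MeasureTheory ProbabilityTheory
open scoped ENNReal RealInnerProductSpace

/-- The standard Gaussian measure on `ℝ^d`. -/
noncomputable def stdGaussian (d : ℕ) : Measure (EuclideanSpace ℝ (Fin d)) :=
  Measure.map (EuclideanSpace.equiv (Fin d) ℝ).symm
    (Measure.pi fun _ : Fin d => gaussianReal 0 1)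

/-- The uniform distribution on the unit sphere `S^{d-1}`, realized as the pushforward of
the standard Gaussian under radial normalization. -/
noncomputable def sphereUniform (d : ℕ) : Measure (EuclideanSpace ℝ (Fin d)) :=
  Measure.map (fun x => ‖x‖⁻¹ • x) (stdGaussian d)

section SqrtTail

variable {Ω : Type*} [MeasurableSpace Ω]

/-- The integral `∫₀^∞ √(P(f > t)) dt`. -/
noncomputable def sqrtTailIntegral (P : Measure Ω) (f : Ω → ℝ) : ℝ≥0∞ :=
  ∫⁻ t in Set.Ioi (0 : ℝ), ENNReal.ofReal (Real.sqrt ((P {ω | f ω > t}).toReal))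

variable (P : Measure Ω)

lemma sqrtTailIntegral_zero : sqrtTailIntegral P (fun _ => 0) = 0 := by
  refine (setLIntegral_congr_fun measurableSet_Ioi (g := fun _ => 0) fun t ht => ?_).trans
    (by simp)
  have h : {ω : Ω | (0 : ℝ) > t} = ∅ := by
    ext ω
    simpa using le_of_lt ht
  simp [h]

lemma ofReal_sqrt_measure_union_le (s t : Set Ω) :
    ENNReal.ofReal (Real.sqrt (P (s ∪ t)).toReal) ≤
      ENNReal.ofReal (Real.sqrt (P s).toReal) + ENNReal.ofReal (Real.sqrt (P t).toReal) := by
  rw [← ENNReal.ofReal_add (Real.sqrt_nonneg _) (Real.sqrt_nonneg _)]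
  refine ENNReal.ofReal_le_ofReal ?_
  have h : (P (s ∪ t)).toReal ≤ (P s).toReal + (P t).toReal := measureReal_union_le s t
  have hs := Real.sq_sqrt (ENNReal.toReal_nonneg (a := P s))
  have ht := Real.sq_sqrt (ENNReal.toReal_nonneg (a := P t))
  rw [Real.sqrt_le_left (by positivity)]
  nlinarith [Real.sqrt_nonneg (P s).toReal, Real.sqrt_nonneg (P t).toReal,
    mul_nonneg (Real.sqrt_nonneg (P s).toReal) (Real.sqrt_nonneg (P t).toReal)]

variable [IsFiniteMeasure P]

lemma ofReal_sqrt_measure_mono {s t : Set Ω} (h : s ⊆ t) :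
    ENNReal.ofReal (Real.sqrt (P s).toReal) ≤ ENNReal.ofReal (Real.sqrt (P t).toReal) :=
  ENNReal.ofReal_le_ofReal <| Real.sqrt_le_sqrt <|
    ENNReal.toReal_mono (measure_ne_top P t) (measure_mono h)

lemma antitone_ofReal_sqrt_tail (f : Ω → ℝ) :
    Antitone fun t : ℝ => ENNReal.ofReal (Real.sqrt ((P {ω | f ω > t}).toReal)) :=
  fun _ _ hst => ofReal_sqrt_measure_mono P fun _ hω => lt_of_le_of_lt hst hω

lemma sqrtTailIntegral_mono {f g : Ω → ℝ} (h : ∀ ω, f ω ≤ g ω) :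
    sqrtTailIntegral P f ≤ sqrtTailIntegral P g :=
  lintegral_mono fun _ => ofReal_sqrt_measure_mono P fun ω hω => lt_of_lt_of_le hω (h ω)

lemma sqrtTailIntegral_const_mul {c : ℝ} (hc : 0 < c) (f : Ω → ℝ) :
    sqrtTailIntegral P (fun ω => c * f ω) = ENNReal.ofReal c * sqrtTailIntegral P f := by
  set F : ℝ → ℝ≥0∞ := fun t => ENNReal.ofReal (Real.sqrt ((P {ω | f ω > t}).toReal)) with hF
  have hFm : Measurable F := (antitone_ofReal_sqrt_tail P f).measurable
  have hmap := Real.map_volume_mul_left (inv_pos.2 hc).ne'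
  rw [inv_inv, abs_of_pos hc] at hmap
  calc sqrtTailIntegral P (fun ω => c * f ω)
      = ∫⁻ t, (Set.Ioi (0 : ℝ)).indicator F (c⁻¹ * t) := by
        rw [sqrtTailIntegral, ← lintegral_indicator measurableSet_Ioi]
        refine lintegral_congr fun t => ?_
        have ht : c⁻¹ * t ∈ Set.Ioi (0 : ℝ) ↔ t ∈ Set.Ioi (0 : ℝ) := by
          simp [hc]
        have hset : {ω | c * f ω > t} = {ω | f ω > c⁻¹ * t} := by
          ext ω
          simp only [Set.mem_ofPred_eq, gt_iff_lt]
          rw [inv_mul_lt_iff₀ hc]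
        by_cases h : t ∈ Set.Ioi (0 : ℝ)
        · rw [Set.indicator_of_mem h, Set.indicator_of_mem (ht.2 h), hset]
        · rw [Set.indicator_of_notMem h, Set.indicator_of_notMem (mt ht.1 h)]
    _ = ∫⁻ t, (Set.Ioi (0 : ℝ)).indicator F t ∂(Measure.map (c⁻¹ * ·) volume) :=
        (lintegral_map (hFm.indicator measurableSet_Ioi) (measurable_const_mul _)).symm
    _ = ENNReal.ofReal c * sqrtTailIntegral P f := by
        rw [hmap, lintegral_smul_measure, lintegral_indicator measurableSet_Ioi]
        rfl

lemma sqrtTailIntegral_add_le (f g : Ω → ℝ) :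
    sqrtTailIntegral P (fun ω => f ω + g ω) ≤
      sqrtTailIntegral P (fun ω => 2 * f ω) + sqrtTailIntegral P (fun ω => 2 * g ω) := by
  simp only [sqrtTailIntegral]
  rw [← lintegral_add_left (antitone_ofReal_sqrt_tail P _).measurable]
  refine lintegral_mono fun t => (ofReal_sqrt_measure_mono P fun ω hω => ?_).trans
    (ofReal_sqrt_measure_union_le P _ _)
  simp only [Set.mem_ofPred_eq, Set.mem_union, gt_iff_lt] at hω ⊢
  by_contra! h
  linarith [h.1, h.2]

lemma sqrtTailIntegral_add_ne_top {f g : Ω → ℝ} (hf : sqrtTailIntegral P f ≠ ∞)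
    (hg : sqrtTailIntegral P g ≠ ∞) : sqrtTailIntegral P (fun ω => f ω + g ω) ≠ ∞ := by
  refine ne_top_of_le_ne_top ?_ (sqrtTailIntegral_add_le P f g)
  rw [sqrtTailIntegral_const_mul P two_pos, sqrtTailIntegral_const_mul P two_pos]
  finiteness

lemma sqrtTailIntegral_sum_ne_top {ι : Type*} (s : Finset ι) {f : ι → Ω → ℝ}
    (hf : ∀ i ∈ s, sqrtTailIntegral P (f i) ≠ ∞) :
    sqrtTailIntegral P (fun ω => ∑ i ∈ s, f i ω) ≠ ∞ := by
  classical
  induction s using Finset.induction_on with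
  | empty => simp [sqrtTailIntegral_zero]
  | insert i s hi ih =>
    simp only [Finset.sum_insert hi]
    exact sqrtTailIntegral_add_ne_top P (hf i (Finset.mem_insert_self i s))
      (ih fun j hj => hf j (Finset.mem_insert_of_mem hj))

/-- The directions in which the projections of `X` have an integrable square-root tail form a
subspace. -/
noncomputable def sqrtTailSubmodule {E : Type*} [NormedAddCommGroup E] [InnerProductSpace ℝ E]
    (X : Ω → E) : Submodule ℝ E where
  carrier := {θ | sqrtTailIntegral P (fun ω => |⟪θ, X ω⟫|) ≠ ∞}
  zero_mem' := by simp [sqrtTailIntegral_zero]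
  add_mem' {x y} hx hy := by
    refine ne_top_of_le_ne_top (sqrtTailIntegral_add_ne_top P hx hy)
      (sqrtTailIntegral_mono P fun ω => ?_)
    rw [inner_add_left]
    exact abs_add_le _ _
  smul_mem' c x hx := by
    rcases eq_or_ne c 0 with rfl | hc
    · simp [sqrtTailIntegral_zero]
    · simp only [Set.mem_ofPred_eq, real_inner_smul_left, abs_mul] at hx ⊢
      rw [sqrtTailIntegral_const_mul P (abs_pos.2 hc)]
      finiteness

lemma measurable_sqrtTailIntegral_inner {E : Type*} [NormedAddCommGroup E]
    [InnerProductSpace ℝ E] [MeasurableSpace E] [BorelSpace E] [SecondCountableTopology E]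
    {X : Ω → E} (hX : Measurable X) :
    Measurable fun θ : E => sqrtTailIntegral P (fun ω => |⟪θ, X ω⟫|) := by
  have hs : MeasurableSet {q : (E × ℝ) × Ω | |⟪q.1.1, X q.2⟫| > q.1.2} := by
    refine measurableSet_lt (by fun_prop) ?_
    have h : Measurable fun q : (E × ℝ) × Ω => ⟪q.1.1, X q.2⟫ :=
      measurable_fst.fst.inner (hX.comp measurable_snd)
    exact h.abs
  have h := measurable_measure_prodMk_left (ν := P) hs
  exact (Measurable.lintegral_prod_right'
    (f := fun p : E × ℝ => ENNReal.ofReal (Real.sqrt ((P {ω | |⟪p.1, X ω⟫| > p.2}).toReal)))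
    h.ennreal_toReal.sqrt.ennreal_ofReal)

end SqrtTail

lemma EuclideanSpace.norm_le_sum_abs_inner {ι : Type*} [Fintype ι] [DecidableEq ι]
    (x : EuclideanSpace ℝ ι) : ‖x‖ ≤ ∑ i, |⟪EuclideanSpace.single i (1 : ℝ), x⟫| := by
  calc ‖x‖ = ‖∑ i, ⟪EuclideanSpace.basisFun ι ℝ i, x⟫ • EuclideanSpace.basisFun ι ℝ i‖ := by
        rw [(EuclideanSpace.basisFun ι ℝ).sum_repr' x]
    _ ≤ ∑ i, ‖⟪EuclideanSpace.basisFun ι ℝ i, x⟫ • EuclideanSpace.basisFun ι ℝ i‖ :=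
        norm_sum_le _ _
    _ = _ := by simp [norm_smul]

lemma stdGaussian_eq (d : ℕ) :
    _root_.stdGaussian d = ProbabilityTheory.stdGaussian (EuclideanSpace ℝ (Fin d)) :=
  map_pi_eq_stdGaussian

/-- A subspace of full standard Gaussian measure is the whole space. -/
lemma eq_top_of_ae_mem_stdGaussian {E : Type*} [NormedAddCommGroup E] [InnerProductSpace ℝ E]
    [FiniteDimensional ℝ E] [MeasurableSpace E] [BorelSpace E] (S : Submodule ℝ E)
    (h : ∀ᵐ x ∂(ProbabilityTheory.stdGaussian E), x ∈ S) : S = ⊤ := by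
  by_contra hS
  obtain ⟨u, hu, hu0⟩ := Submodule.exists_mem_ne_zero_of_ne_bot
    (mt Submodule.orthogonal_eq_bot_iff.1 hS)
  have hmap := IsGaussian.map_eq_gaussianReal (μ := ProbabilityTheory.stdGaussian E)
    (innerSL ℝ u)
  rw [variance_dual_stdGaussian, integral_strongDual_stdGaussian, innerSL_apply_norm] at hmap
  have hv : (‖u‖ ^ 2).toNNReal ≠ 0 := by
    simpa using hu0
  have := nullSingletonClass_gaussianReal (μ := 0) hv
  have hzero : ∀ᵐ x ∂(ProbabilityTheory.stdGaussian E), innerSL ℝ u x ≠ 0 := by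
    refine ae_of_ae_map (p := fun y : ℝ => y ≠ 0) (innerSL ℝ u).continuous.aemeasurable ?_
    rw [hmap]
    exact Measure.ae_ne _ 0
  obtain ⟨x, hxS, hx⟩ := (h.and hzero).exists
  exact hx (Submodule.inner_left_of_mem_orthogonal hxS hu)

theorem proj_tail_sqrt_integrable_iff {Ω : Type*} [MeasurableSpace Ω]
    (P : Measure Ω) [IsProbabilityMeasure P] {d : ℕ} (hd : 0 < d)
    (X : Ω → EuclideanSpace ℝ (Fin d)) (hX : Measurable X) :
    (∫⁻ θ, (∫⁻ t in Set.Ioi (0:ℝ),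
        ENNReal.ofReal (Real.sqrt ((P {ω | |⟪θ, X ω⟫| > t}).toReal))) ∂(sphereUniform d))
        ≠ ∞ ↔
      (∫⁻ t in Set.Ioi (0:ℝ),
        ENNReal.ofReal (Real.sqrt ((P {ω | ‖X ω‖ > t}).toReal))) ≠ ∞ := by
  change (∫⁻ θ, sqrtTailIntegral P (fun ω => |⟪θ, X ω⟫|) ∂(sphereUniform d)) ≠ ∞ ↔
    sqrtTailIntegral P (fun ω => ‖X ω‖) ≠ ∞
  have hnormalize : Measurable fun x : EuclideanSpace ℝ (Fin d) => ‖x‖⁻¹ • x := by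
    fun_prop
  rw [sphereUniform, stdGaussian_eq]
  constructor
  · intro h
    have hsphere := ae_of_ae_map hnormalize.aemeasurable
      (ae_lt_top (measurable_sqrtTailIntegral_inner P hX) h)
    have htop : sqrtTailSubmodule P X = ⊤ := by
      refine eq_top_of_ae_mem_stdGaussian _ (hsphere.mono fun x hx => ?_)
      have hmem : ‖x‖⁻¹ • x ∈ sqrtTailSubmodule P X := hx.ne
      rcases eq_or_ne x 0 with rfl | hx0
      · exact zero_mem _
      · simpa [smul_smul, hx0] using (sqrtTailSubmodule P X).smul_mem ‖x‖ hmem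
    have hbasis (i : Fin d) :
        EuclideanSpace.single i (1 : ℝ) ∈ sqrtTailSubmodule P X := htop ▸ Submodule.mem_top
    exact ne_top_of_le_ne_top (sqrtTailIntegral_sum_ne_top P Finset.univ fun i _ => hbasis i)
      (sqrtTailIntegral_mono P fun ω => EuclideanSpace.norm_le_sum_abs_inner (X ω))
  · intro h
    refine ne_top_of_le_ne_top h ((lintegral_map_le _ _).trans ?_)
    refine (lintegral_mono (g := fun _ => sqrtTailIntegral P (fun ω => ‖X ω‖)) fun x =>
      sqrtTailIntegral_mono P fun ω => ?_).trans (by simp)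
    refine (abs_real_inner_le_norm _ _).trans (mul_le_of_le_one_left (norm_nonneg _) ?_)
    rw [norm_smul, norm_inv, norm_norm]
    exact inv_mul_le_one
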